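/- arXiv:2209.14278 — 2 statements merged into one kernel-verified Lean document; each statement's English description precedes it below -/
import Mathlib

section
/- Let F(x) = Σ_{j=−L}^{L} c_j e^{ijx} be a trigonometric polynomial with complex coefficients such that |F(x)| ≤ 1 for all x ∈ ℝ. Then there exist ω ∈ ℝ and θ, φ ∈ ℝ^{2L+1} such that the (0,0) entry of the trigonometric QSP unitary satisfies (W^{2L}_{ω,θ,φ}(x))_{00} = F(x) for all x ∈ ℝ. -/
open scoped Matrix

/-- `R_z(φ) = diag(e^{-iφ/2}, e^{iφ/2})`. -/
noncomputable def Rz (φ : ℝ) : Matrix (Fin 2) (Fin 2) ℂ :=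
  !![Complex.exp (-(Complex.I * φ / 2)), 0; 0, Complex.exp (Complex.I * φ / 2)]

/-- `R_y(θ)`, the real rotation by angle `θ/2`, viewed as a complex matrix. -/
noncomputable def Ry (θ : ℝ) : Matrix (Fin 2) (Fin 2) ℂ :=
  !![(Real.cos (θ / 2) : ℂ), -(Real.sin (θ / 2) : ℂ);
     (Real.sin (θ / 2) : ℂ), (Real.cos (θ / 2) : ℂ)]

/-- The trigonometric QSP unitary
`W^L_{ω,θ,φ}(x) = R_z(ω) R_y(θ_0) R_z(φ_0) ∏_{l=1}^{L} [R_z(x) R_y(θ_l) R_z(φ_l)]`,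
multiplied left to right in increasing `l`. -/
noncomputable def Wqsp (L : ℕ) (ω : ℝ) (θ φ : ℕ → ℝ) (x : ℝ) :
    Matrix (Fin 2) (Fin 2) ℂ :=
  Rz ω * Ry (θ 0) * Rz (φ 0) *
    ((List.range L).map (fun l => Rz x * Ry (θ (l + 1)) * Rz (φ (l + 1)))).prod

open Polynomial ComplexConjugate ComplexOrder

/-- The conjugate-reciprocal of `P` with respect to the formal degree `N`. -/
noncomputable def conjReflect (N : ℕ) (P : ℂ[X]) : ℂ[X] :=
  reflect N (P.map (starRingEnd ℂ))

theorem coeff_conjReflect {N k : ℕ} (hk : k ≤ N) (P : ℂ[X]) :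
    (conjReflect N P).coeff k = conj (P.coeff (N - k)) := by
  simp [conjReflect, coeff_reflect, revAt_le hk]

theorem natDegree_conjReflect_le {N : ℕ} {P : ℂ[X]} (hP : P.natDegree ≤ N) :
    (conjReflect N P).natDegree ≤ N := by
  rw [natDegree_le_iff_coeff_eq_zero]
  intro k hk
  rw [conjReflect, coeff_reflect, revAt_eq_self_of_lt hk, coeff_map,
    coeff_eq_zero_of_natDegree_lt (by omega), map_zero]

theorem eval_conjReflect_mul_pow {N : ℕ} {P : ℂ[X]} (hP : P.natDegree ≤ N) {z : ℂ} (hz : z ≠ 0) :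
    (conjReflect N P).eval (conj z)⁻¹ * conj z ^ N = conj (P.eval z) := by
  have hz' : conj z ≠ 0 := by simpa using hz
  let _ : Invertible (conj z) := invertibleOfNonzero hz'
  have h := eval₂_reflect_mul_pow (RingHom.id ℂ) (conj z) N (P.map (starRingEnd ℂ))
    (natDegree_map_le.trans hP)
  rw [invOf_eq_inv] at h
  simpa [conjReflect, eval₂_id, eval_map, eval₂_hom] using h

theorem conj_mul_self_of_norm_eq_one {z : ℂ} (hz : ‖z‖ = 1) : conj z * z = 1 := by
  rw [mul_comm, Complex.mul_conj, Complex.normSq_eq_norm_sq, hz]; simp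

theorem ne_zero_of_norm_eq_one {z : ℂ} (hz : ‖z‖ = 1) : z ≠ 0 := by
  rintro rfl; simp at hz

theorem conj_pow_mul_eval_conjReflect {N : ℕ} {P : ℂ[X]} (hP : P.natDegree ≤ N) {z : ℂ}
    (hz : ‖z‖ = 1) : conj z ^ N * (conjReflect N P).eval z = conj (P.eval z) := by
  have h := eval_conjReflect_mul_pow hP (ne_zero_of_norm_eq_one hz)
  rwa [inv_eq_of_mul_eq_one_right (conj_mul_self_of_norm_eq_one hz), mul_comm] at h

theorem infinite_setOf_norm_eq_one : {z : ℂ | ‖z‖ = 1}.Infinite := by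
  have h : (Set.Ioo (0 : ℝ) 1).Infinite := Set.Ioo_infinite one_pos
  have hinj : Set.InjOn (fun x : ℝ => Complex.exp (x * Complex.I)) (Set.Ioo 0 1) := by
    intro x hx y hy hxy
    have hpi := Real.pi_gt_three
    have h1 := congrArg Complex.arg hxy
    simp only [Complex.arg_exp_mul_I] at h1
    rwa [(toIocMod_eq_self _).2 ⟨by linarith [hx.1], by linarith [hx.2]⟩,
      (toIocMod_eq_self _).2 ⟨by linarith [hy.1], by linarith [hy.2]⟩] at h1
  refine (h.image hinj).mono ?_
  rintro _ ⟨x, -, rfl⟩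
  exact Complex.norm_exp_ofReal_mul_I x

theorem eq_of_eval_eq_on_circle {P Q : ℂ[X]} (h : ∀ z : ℂ, ‖z‖ = 1 → P.eval z = Q.eval z) :
    P = Q :=
  eq_of_infinite_eval_eq P Q (infinite_setOf_norm_eq_one.mono h)

theorem eq_of_conj_pow_mul_eval_eq_on_circle {n : ℕ} {P Q : ℂ[X]}
    (h : ∀ z : ℂ, ‖z‖ = 1 → conj z ^ n * P.eval z = conj z ^ n * Q.eval z) : P = Q :=
  eq_of_eval_eq_on_circle fun z hz =>
    mul_left_cancel₀ (pow_ne_zero n (by simpa using ne_zero_of_norm_eq_one hz)) (h z hz)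

/-- If `z⁻ⁿ R(z)` is real on the unit circle then `R` is self-inversive. -/
theorem conjReflect_eq_self {n : ℕ} {R : ℂ[X]} (hR : R.natDegree ≤ 2 * n)
    (hpos : ∀ z : ℂ, ‖z‖ = 1 → 0 ≤ conj z ^ n * R.eval z) : conjReflect (2 * n) R = R := by
  refine eq_of_conj_pow_mul_eval_eq_on_circle (n := 2 * n) fun z hz => ?_
  have hreal : conj (conj z ^ n * R.eval z) = conj z ^ n * R.eval z :=
    Complex.conj_eq_iff_im.2 (Complex.nonneg_iff.1 (hpos z hz)).2.symm
  have h1 : conj z ^ n * z ^ n = 1 := by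
    rw [← mul_pow, conj_mul_self_of_norm_eq_one hz, one_pow]
  rw [conj_pow_mul_eval_conjReflect hR hz]
  simp only [map_mul, map_pow, Complex.conj_conj] at hreal
  rw [two_mul, pow_add]
  linear_combination conj z ^ n * hreal - conj (R.eval z) * h1

theorem exists_exp_mul_I_eq {z : ℂ} (hz : ‖z‖ = 1) : ∃ x : ℝ, Complex.exp (x * Complex.I) = z :=
  ⟨z.arg, by simpa [hz] using Complex.norm_mul_exp_arg_mul_I z⟩

/-- A function that is nonnegative on the unit circle minus a point is nonnegative on it. -/
theorem nonneg_on_circle_of_ne {g : ℂ → ℂ} (hg : Continuous g) (a : ℂ)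
    (h : ∀ z : ℂ, ‖z‖ = 1 → z ≠ a → 0 ≤ g z) (z : ℂ) (hz : ‖z‖ = 1) : 0 ≤ g z := by
  obtain ⟨x, rfl⟩ := exists_exp_mul_I_eq hz
  have hcount : {y : ℝ | Complex.exp (y * Complex.I) = a}.Countable := by
    by_cases hne : ∃ y₀ : ℝ, Complex.exp (y₀ * Complex.I) = a
    · obtain ⟨y₀, rfl⟩ := hne
      refine (Set.countable_range fun k : ℤ => y₀ + k * (2 * Real.pi)).mono fun y hy => ?_
      obtain ⟨k, hk⟩ := Complex.exp_eq_exp_iff_exists_int.1 hy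
      refine ⟨k, ?_⟩
      have := congrArg Complex.im hk
      simpa using this.symm
    · exact (Set.countable_empty).mono fun y hy => hne ⟨y, hy⟩
  have hclosed : IsClosed {y : ℝ | 0 ≤ g (Complex.exp (y * Complex.I))} :=
    isClosed_le continuous_const (by fun_prop)
  have hsub : {y : ℝ | Complex.exp (y * Complex.I) = a}ᶜ ⊆
      {y : ℝ | 0 ≤ g (Complex.exp (y * Complex.I))} := fun y hy =>
    h _ (Complex.norm_exp_ofReal_mul_I y) hy
  exact hclosed.closure_subset_iff.2 hsub ((hcount.dense_compl ℝ) x)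

/-- A root on the unit circle of a polynomial with `z⁻ⁿ R(z) ≥ 0` there is a multiple root. -/
theorem eval_derivative_eq_zero_of_root_on_circle {n : ℕ} {R : ℂ[X]}
    (hpos : ∀ z : ℂ, ‖z‖ = 1 → 0 ≤ conj z ^ n * R.eval z) {a : ℂ} (ha : ‖a‖ = 1)
    (hroot : R.eval a = 0) : R.derivative.eval a = 0 := by
  obtain ⟨x, rfl⟩ := exists_exp_mul_I_eq ha
  set g : ℝ → ℂ := fun y =>
    Complex.exp (-(y * Complex.I)) ^ n * R.eval (Complex.exp (y * Complex.I)) with hg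
  have hgpos : ∀ y, 0 ≤ g y := by
    intro y
    have := hpos _ (Complex.norm_exp_ofReal_mul_I y)
    rwa [← Complex.exp_conj, map_mul, Complex.conj_ofReal, Complex.conj_I, mul_neg] at this
  have hlin : HasDerivAt (fun y : ℝ => (y : ℂ) * Complex.I) Complex.I x := by
    simpa using (Complex.ofRealCLM.hasDerivAt (x := x)).mul_const Complex.I
  have hexp := hlin.cexp
  have hR := (R.hasDerivAt (Complex.exp (x * Complex.I))).comp x hexp
  have hE := (hlin.neg.cexp).pow n
  have hgd := hE.mul hR
  obtain ⟨D, hD⟩ : ∃ D : ℂ, HasDerivAt g D x := ⟨_, hgd⟩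
  have hg0 : g x = 0 := by simp [hg, hroot]
  have hre : HasDerivAt (fun y => (g y).re) D.re x :=
    Complex.reCLM.hasFDerivAt.comp_hasDerivAt x hD
  have him : HasDerivAt (fun y => (g y).im) D.im x :=
    Complex.imCLM.hasFDerivAt.comp_hasDerivAt x hD
  have hre0 : D.re = 0 := by
    refine IsLocalMin.hasDerivAt_eq_zero (Filter.Eventually.of_forall fun y => ?_) hre
    simpa [hg0] using (Complex.nonneg_iff.1 (hgpos y)).1
  have him0 : D.im = 0 := by
    have : (fun y => (g y).im) = fun _ => 0 :=
      funext fun y => (Complex.nonneg_iff.1 (hgpos y)).2.symm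
    rw [this] at him
    exact him.unique (hasDerivAt_const x 0)
  have hD0 : D = 0 := Complex.ext hre0 him0
  have hzero := hgd.unique (hD0 ▸ hD)
  simpa [hroot, Complex.exp_ne_zero] using hzero

/-- **Fejér–Riesz theorem**: a nonnegative trigonometric polynomial is the squared modulus of a
polynomial on the unit circle. -/
theorem fejer_riesz (n : ℕ) (R : ℂ[X]) (hR : R.natDegree ≤ 2 * n)
    (hpos : ∀ z : ℂ, ‖z‖ = 1 → 0 ≤ conj z ^ n * R.eval z) :
    ∃ Q : ℂ[X], Q.natDegree ≤ n ∧
      ∀ z : ℂ, ‖z‖ = 1 → conj z ^ n * R.eval z = Q.eval z * conj (Q.eval z) := by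
  induction n generalizing R with
  | zero =>
    obtain ⟨r, rfl⟩ : ∃ r, R = C r := ⟨_, eq_C_of_natDegree_le_zero hR⟩
    have hr : 0 ≤ r := by simpa using hpos 1 (by simp)
    obtain ⟨hr1, hr2⟩ := Complex.nonneg_iff.1 hr
    refine ⟨C (Real.sqrt r.re : ℂ), by simp, fun z _ => ?_⟩
    simp only [pow_zero, one_mul, eval_C, Complex.conj_ofReal, ← Complex.ofReal_mul,
      Real.mul_self_sqrt hr1]
    exact Complex.ext (by simp) (by simp [← hr2])
  | succ n ih =>
    have hself := conjReflect_eq_self hR hpos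
    have hlead : R.coeff (2 * (n + 1)) = conj (R.coeff 0) := by
      conv_lhs => rw [← hself, coeff_conjReflect le_rfl, Nat.sub_self]
    by_cases h0 : R.coeff 0 = 0
    · have hX : R = X * R.divX := by
        conv_lhs => rw [← X_mul_divX_add R, h0, C_0, add_zero]
      have hev : ∀ z : ℂ, ‖z‖ = 1 →
          conj z ^ n * R.divX.eval z = conj z ^ (n + 1) * R.eval z := by
        intro z hz
        conv_rhs => rw [hX]
        rw [eval_mul, eval_X, pow_succ]
        linear_combination -(conj z ^ n * R.divX.eval z) * conj_mul_self_of_norm_eq_one hz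
      obtain ⟨Q, hQ, hQe⟩ := ih R.divX (by
          rw [natDegree_le_iff_coeff_eq_zero]
          intro k hk
          rw [coeff_divX]
          rcases (show 2 * (n + 1) ≤ k + 1 by omega).eq_or_lt with h | h
          · rw [← h, hlead, h0, map_zero]
          · exact coeff_eq_zero_of_natDegree_lt (by omega))
        fun z hz => by rw [hev z hz]; exact hpos z hz
      exact ⟨Q, hQ.trans n.le_succ, fun z hz => by rw [← hev z hz, hQe z hz]⟩
    · have hdeg : R.natDegree = 2 * (n + 1) :=
        le_antisymm hR (le_natDegree_of_ne_zero (by rw [hlead]; simpa using h0))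
      obtain ⟨a, ha⟩ : ∃ a, R.IsRoot a := Complex.exists_root
        (natDegree_pos_iff_degree_pos.1 (by omega))
      have ha0 : a ≠ 0 := by
        rintro rfl
        exact h0 (by rw [coeff_zero_eq_eval_zero]; exact ha)
      have hca0 : conj a ≠ 0 := by simpa using ha0
      obtain ⟨S, hS⟩ := dvd_iff_isRoot.2 ha
      have hSroot : S.IsRoot (conj a)⁻¹ := by
        by_cases hnorm : ‖a‖ = 1
        · have hd := eval_derivative_eq_zero_of_root_on_circle hpos hnorm ha
          rw [inv_eq_of_mul_eq_one_right (conj_mul_self_of_norm_eq_one hnorm)]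
          rw [hS] at hd
          simpa [derivative_mul] using hd
        · have h1 := eval_conjReflect_mul_pow hR ha0
          rw [hself, show R.eval a = 0 from ha, map_zero, hS, eval_mul] at h1
          have h2 : (X - C a).eval (conj a)⁻¹ ≠ 0 := by
            simp only [eval_sub, eval_X, eval_C, sub_ne_zero]
            intro h
            apply hnorm
            have h3 := congrArg norm h
            rw [norm_inv, RCLike.norm_conj] at h3
            have h4 : ‖a‖ ≠ 0 := by simpa using ha0
            field_simp at h3
            nlinarith [norm_nonneg a]
          exact (mul_eq_zero.1
            ((mul_eq_zero.1 h1).resolve_right (pow_ne_zero _ hca0))).resolve_left h2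
      obtain ⟨T, hT⟩ := dvd_iff_isRoot.2 hSroot
      have hR0 : R ≠ 0 := by rintro rfl; simp at h0
      have hT0 : T ≠ 0 := by
        rintro rfl
        exact hR0 (by rw [hS, hT]; simp)
      have hTdeg : T.natDegree = 2 * n := by
        have := hdeg
        rw [hS, hT, natDegree_mul (X_sub_C_ne_zero _) (mul_ne_zero (X_sub_C_ne_zero _) hT0),
          natDegree_mul (X_sub_C_ne_zero _) hT0, natDegree_X_sub_C, natDegree_X_sub_C] at this
        omega
      set R' : ℂ[X] := C (-(conj a)⁻¹) * T with hR'
      have hev : ∀ z : ℂ, ‖z‖ = 1 → conj z ^ (n + 1) * R.eval z =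
          ((z - a) * conj (z - a)) * (conj z ^ n * R'.eval z) := by
        intro z hz
        have h1 := conj_mul_self_of_norm_eq_one hz
        have h2 : conj a * (conj a)⁻¹ = 1 := mul_inv_cancel₀ hca0
        rw [hS, hT, hR']
        simp only [eval_mul, eval_sub, eval_X, eval_C, map_sub, pow_succ]
        linear_combination (conj z ^ n * (z - a) * T.eval z) * (h1 - h2)
      have hpos' : ∀ z : ℂ, ‖z‖ = 1 → 0 ≤ conj z ^ n * R'.eval z := by
        refine nonneg_on_circle_of_ne (by fun_prop) a fun z hz hza => ?_
        have h1 := hpos z hz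
        rw [hev z hz, Complex.mul_conj] at h1
        have h2 : 0 < Complex.normSq (z - a) := Complex.normSq_pos.2 (sub_ne_zero.2 hza)
        rw [Complex.nonneg_iff, Complex.re_ofReal_mul, Complex.im_ofReal_mul] at h1
        exact Complex.nonneg_iff.2 ⟨(mul_nonneg_iff_of_pos_left h2).1 h1.1,
          ((mul_eq_zero.1 h1.2.symm).resolve_left h2.ne').symm⟩
      obtain ⟨Q, hQ, hQe⟩ := ih R' ((natDegree_C_mul_le _ _).trans hTdeg.le) hpos'
      refine ⟨(X - C a) * Q, ?_, fun z hz => ?_⟩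
      · refine natDegree_mul_le.trans ?_
        rw [natDegree_X_sub_C]
        omega
      · rw [hev z hz, hQe z hz]
        simp only [eval_mul, eval_sub, eval_X, eval_C, map_mul]
        ring

/-- A polynomial bounded by one on the unit circle can be completed to a unit row vector. -/
theorem exists_complementary_polynomial {n : ℕ} {P : ℂ[X]} (hP : P.natDegree ≤ n)
    (hbound : ∀ z : ℂ, ‖z‖ = 1 → ‖P.eval z‖ ≤ 1) :
    ∃ Q : ℂ[X], Q.natDegree ≤ n ∧ ∀ z : ℂ, ‖z‖ = 1 →
      P.eval z * conj (P.eval z) + Q.eval z * conj (Q.eval z) = 1 := by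
  have hev : ∀ z : ℂ, ‖z‖ = 1 → conj z ^ n * (X ^ n - P * conjReflect n P).eval z =
      1 - P.eval z * conj (P.eval z) := by
    intro z hz
    have h1 : conj z ^ n * z ^ n = 1 := by
      rw [← mul_pow, conj_mul_self_of_norm_eq_one hz, one_pow]
    simp only [eval_sub, eval_pow, eval_X, eval_mul]
    linear_combination h1 - P.eval z * conj_pow_mul_eval_conjReflect hP hz
  obtain ⟨Q, hQ, hQe⟩ := fejer_riesz n (X ^ n - P * conjReflect n P) (by
      refine (natDegree_sub_le _ _).trans (max_le ((natDegree_X_pow_le n).trans (by omega)) ?_)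
      refine natDegree_mul_le.trans ?_
      have := natDegree_conjReflect_le hP
      omega)
    fun z hz => by
      rw [hev z hz, Complex.mul_conj, Complex.normSq_eq_norm_sq, sub_nonneg]
      exact_mod_cast pow_le_one₀ (norm_nonneg _) (hbound z hz)
  exact ⟨Q, hQ, fun z hz => by rw [← hQe z hz, hev z hz]; ring⟩

/-- Extremal coefficients of a unit row vector of polynomials are orthogonal. -/
theorem coeff_mul_conj_coeff_zero_add_eq_zero {n : ℕ} (hn : n ≠ 0) {P Q : ℂ[X]}
    (hP : P.natDegree ≤ n) (hQ : Q.natDegree ≤ n)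
    (h : ∀ z : ℂ, ‖z‖ = 1 → P.eval z * conj (P.eval z) + Q.eval z * conj (Q.eval z) = 1) :
    P.coeff n * conj (P.coeff 0) + Q.coeff n * conj (Q.coeff 0) = 0 := by
  have hpoly : P * conjReflect n P + Q * conjReflect n Q = X ^ n := by
    refine eq_of_conj_pow_mul_eval_eq_on_circle (n := n) fun z hz => ?_
    have h1 : conj z ^ n * z ^ n = 1 := by
      rw [← mul_pow, conj_mul_self_of_norm_eq_one hz, one_pow]
    simp only [eval_add, eval_pow, eval_X, eval_mul]
    linear_combination P.eval z * conj_pow_mul_eval_conjReflect hP hz +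
      Q.eval z * conj_pow_mul_eval_conjReflect hQ hz + h z hz - h1
  have hc := congrArg (fun p : ℂ[X] => p.coeff (n + n)) hpoly
  simp only [coeff_add] at hc
  rw [coeff_mul_add_eq_of_natDegree_le hP (natDegree_conjReflect_le hP),
    coeff_mul_add_eq_of_natDegree_le hQ (natDegree_conjReflect_le hQ),
    coeff_conjReflect le_rfl, coeff_conjReflect le_rfl, coeff_X_pow,
    if_neg (by omega), Nat.sub_self] at hc
  exact hc

theorem exp_mul_exp_neg_half (y : ℝ) :
    Complex.exp (Complex.I * y / 2) * Complex.exp (-(Complex.I * y / 2)) = 1 := by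
  rw [← Complex.exp_add, add_neg_cancel, Complex.exp_zero]

theorem ofReal_cos_sq_add_sin_sq (y : ℝ) : (Real.cos y : ℂ) ^ 2 + (Real.sin y : ℂ) ^ 2 = 1 := by
  exact_mod_cast Real.cos_sq_add_sin_sq y

theorem conj_exp_I_mul_div_two (φ : ℝ) :
    conj (Complex.exp (Complex.I * φ / 2)) = Complex.exp (-(Complex.I * φ / 2)) := by
  rw [← Complex.exp_conj]
  congr 1
  simp only [map_mul, map_div₀, Complex.conj_I, Complex.conj_ofReal, map_ofNat]
  ring

theorem conj_exp_neg_I_mul_div_two (φ : ℝ) :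
    conj (Complex.exp (-(Complex.I * φ / 2))) = Complex.exp (Complex.I * φ / 2) := by
  rw [← conj_exp_I_mul_div_two, Complex.conj_conj]

/-- First entry of the row vector `(a, b) * (Ry θ * Rz φ)⁻¹`. -/
noncomputable def unrotFst (θ φ : ℝ) (a b : ℂ) : ℂ :=
  a * (Complex.exp (Complex.I * φ / 2) * Real.cos (θ / 2)) -
    b * (Complex.exp (-(Complex.I * φ / 2)) * Real.sin (θ / 2))

/-- Second entry of the row vector `(a, b) * (Ry θ * Rz φ)⁻¹`. -/
noncomputable def unrotSnd (θ φ : ℝ) (a b : ℂ) : ℂ :=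
  a * (Complex.exp (Complex.I * φ / 2) * Real.sin (θ / 2)) +
    b * (Complex.exp (-(Complex.I * φ / 2)) * Real.cos (θ / 2))

theorem unrot_mul_conj_add (θ φ : ℝ) (a b a' b' : ℂ) :
    unrotFst θ φ a b * conj (unrotFst θ φ a' b') + unrotSnd θ φ a b * conj (unrotSnd θ φ a' b') =
      a * conj a' + b * conj b' := by
  simp only [unrotFst, unrotSnd, map_sub, map_add, map_mul, conj_exp_I_mul_div_two,
    conj_exp_neg_I_mul_div_two, Complex.conj_ofReal]
  linear_combination (a * conj a' + b * conj b') *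
    (Complex.exp (Complex.I * φ / 2) * Complex.exp (-(Complex.I * φ / 2)) *
      ofReal_cos_sq_add_sin_sq (θ / 2) + exp_mul_exp_neg_half φ)

theorem row_mul_Ry_mul_Rz (θ φ : ℝ) (a b : ℂ) (M : Matrix (Fin 2) (Fin 2) ℂ)
    (h0 : M 0 0 = unrotFst θ φ a b) (h1 : M 0 1 = unrotSnd θ φ a b) :
    (M * (Ry θ * Rz φ)) 0 0 = a ∧ (M * (Ry θ * Rz φ)) 0 1 = b := by
  simp only [Rz, Ry, Matrix.mul_apply, Fin.sum_univ_two, Matrix.of_apply, Matrix.cons_val',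
    Matrix.cons_val_zero, Matrix.cons_val_one, Matrix.cons_val_fin_one, h0, h1, unrotFst, unrotSnd]
  have h := ofReal_cos_sq_add_sin_sq (θ / 2)
  have he := exp_mul_exp_neg_half φ
  constructor
  · linear_combination a * (Complex.exp (Complex.I * φ / 2) *
      Complex.exp (-(Complex.I * φ / 2)) * h + he)
  · linear_combination b * (Complex.exp (Complex.I * φ / 2) *
      Complex.exp (-(Complex.I * φ / 2)) * h + he)

theorem unrotFst_smul (θ φ : ℝ) (t a b : ℂ) :
    unrotFst θ φ (t * a) (t * b) = t * unrotFst θ φ a b := by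
  simp only [unrotFst]; ring

theorem unrotSnd_smul (θ φ : ℝ) (t a b : ℂ) :
    unrotSnd θ φ (t * a) (t * b) = t * unrotSnd θ φ a b := by
  simp only [unrotSnd]; ring

/-- Angles for which the inverse of `Ry θ * Rz φ` annihilates the second entry of `(a, b)`. -/
theorem exists_angles_snd_eq_zero (a b : ℂ) : ∃ θ φ : ℝ, unrotSnd θ φ a b = 0 := by
  set w : ℂ := ⟨‖a‖, -‖b‖⟩ with hw
  refine ⟨2 * w.arg, b.arg - a.arg, ?_⟩
  have hcos : ‖w‖ * Real.cos w.arg = ‖a‖ := Complex.norm_mul_cos_arg w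
  have hsin : ‖w‖ * Real.sin w.arg = -‖b‖ := Complex.norm_mul_sin_arg w
  by_cases hw0 : w = 0
  · have h1 : ‖a‖ = 0 := by simpa [hw] using congrArg Complex.re hw0
    have h2 : ‖b‖ = 0 := by simpa [hw] using congrArg Complex.im hw0
    rw [norm_eq_zero] at h1 h2
    simp [unrotSnd, h1, h2]
  · have hreal : ‖a‖ * Real.sin w.arg + ‖b‖ * Real.cos w.arg = 0 := by
      apply mul_left_cancel₀ (norm_ne_zero_iff.2 hw0)
      linear_combination ‖a‖ * hsin + ‖b‖ * hcos
    have hrealC : (‖a‖ : ℂ) * (Real.sin w.arg : ℂ) + ‖b‖ * (Real.cos w.arg : ℂ) = 0 := by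
      exact_mod_cast hreal
    have ha : a * Complex.exp (Complex.I * ((b.arg - a.arg : ℝ) : ℂ) / 2) =
        ‖a‖ * Complex.exp (Complex.I * (a.arg + b.arg) / 2) := by
      conv_lhs => rw [← Complex.norm_mul_exp_arg_mul_I a, mul_assoc, ← Complex.exp_add]
      congr 2
      rw [Complex.norm_mul_exp_arg_mul_I]
      push_cast
      ring
    have hb : b * Complex.exp (-(Complex.I * ((b.arg - a.arg : ℝ) : ℂ) / 2)) =
        ‖b‖ * Complex.exp (Complex.I * (a.arg + b.arg) / 2) := by
      conv_lhs => rw [← Complex.norm_mul_exp_arg_mul_I b, mul_assoc, ← Complex.exp_add]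
      congr 2
      rw [Complex.norm_mul_exp_arg_mul_I]
      push_cast
      ring
    rw [unrotSnd, ← mul_assoc, ← mul_assoc, ha, hb, mul_div_cancel_left₀ _ (two_ne_zero' ℝ)]
    linear_combination Complex.exp (Complex.I * (a.arg + b.arg) / 2) * hrealC

/-- Angles for which the inverse of `Ry θ * Rz φ` annihilates the first entry of `(a, b)`. -/
theorem exists_angles_fst_eq_zero (a b : ℂ) : ∃ θ φ : ℝ, unrotFst θ φ a b = 0 := by
  obtain ⟨θ, φ, h⟩ := exists_angles_snd_eq_zero a b
  refine ⟨θ - Real.pi, φ, ?_⟩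
  rw [unrotFst, sub_div, Real.cos_sub_pi_div_two, Real.sin_sub_pi_div_two]
  rw [unrotSnd] at h
  push_cast at h ⊢
  linear_combination h

/-- Angles lowering the degree of a unit row vector of polynomials, given that its extremal
coefficients `(p, q)` and `(p₀, q₀)` are orthogonal. -/
theorem exists_angles_of_orthogonal {p q p₀ q₀ : ℂ} (h : p * conj p₀ + q * conj q₀ = 0) :
    ∃ θ φ : ℝ, unrotSnd θ φ p₀ q₀ = 0 ∧ unrotFst θ φ p q = 0 := by
  by_cases h0 : p₀ = 0 ∧ q₀ = 0
  · obtain ⟨θ, φ, hpq⟩ := exists_angles_fst_eq_zero p q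
    exact ⟨θ, φ, by simp [unrotSnd, h0.1, h0.2], hpq⟩
  · obtain ⟨θ, φ, hs⟩ := exists_angles_snd_eq_zero p₀ q₀
    refine ⟨θ, φ, hs, ?_⟩
    have h1 := unrot_mul_conj_add θ φ p q p₀ q₀
    rw [hs, h, map_zero, mul_zero, add_zero] at h1
    refine (mul_eq_zero.1 h1).resolve_right fun hf => h0 ?_
    have h2 := unrot_mul_conj_add θ φ p₀ q₀ p₀ q₀
    rw [hs, hf, mul_zero, zero_mul, add_zero, Complex.mul_conj, Complex.mul_conj] at h2
    have h3 : Complex.normSq p₀ + Complex.normSq q₀ = 0 := by exact_mod_cast h2.symm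
    have h4 := Complex.normSq_nonneg p₀
    have h5 := Complex.normSq_nonneg q₀
    exact ⟨Complex.normSq_eq_zero.1 (by linarith), Complex.normSq_eq_zero.1 (by linarith)⟩

theorem Wqsp_zero (ω : ℝ) (θ φ : ℕ → ℝ) (x : ℝ) :
    Wqsp 0 ω θ φ x = Rz ω * (Ry (θ 0) * Rz (φ 0)) := by
  simp [Wqsp, mul_assoc]

theorem Wqsp_succ (n : ℕ) (ω : ℝ) (θ φ : ℕ → ℝ) (x : ℝ) :
    Wqsp (n + 1) ω θ φ x =
      Wqsp n ω θ φ x * (Rz x * (Ry (θ (n + 1)) * Rz (φ (n + 1)))) := by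
  simp [Wqsp, List.range_succ, mul_assoc]

theorem Wqsp_congr {n : ℕ} {θ θ' φ φ' : ℕ → ℝ} (hθ : ∀ k ≤ n, θ k = θ' k)
    (hφ : ∀ k ≤ n, φ k = φ' k) (ω x : ℝ) : Wqsp n ω θ φ x = Wqsp n ω θ' φ' x := by
  induction n with
  | zero => rw [Wqsp_zero, Wqsp_zero, hθ 0 le_rfl, hφ 0 le_rfl]
  | succ n ih =>
    rw [Wqsp_succ, Wqsp_succ, hθ _ le_rfl, hφ _ le_rfl,
      ih (fun k hk => hθ k (by omega)) fun k hk => hφ k (by omega)]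

/-- Every unit row vector of polynomials of degree at most `n` is the first row of a QSP unitary,
up to the common phase `e^{-inx/2}`. -/
theorem exists_Wqsp_row_eq (n : ℕ) (P Q : ℂ[X]) (hP : P.natDegree ≤ n) (hQ : Q.natDegree ≤ n)
    (h : ∀ z : ℂ, ‖z‖ = 1 → P.eval z * conj (P.eval z) + Q.eval z * conj (Q.eval z) = 1) :
    ∃ (ω : ℝ) (θ φ : ℕ → ℝ), ∀ x : ℝ,
      Wqsp n ω θ φ x 0 0 =
        Complex.exp (-(Complex.I * x / 2)) ^ n * P.eval (Complex.exp (Complex.I * x)) ∧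
      Wqsp n ω θ φ x 0 1 =
        Complex.exp (-(Complex.I * x / 2)) ^ n * Q.eval (Complex.exp (Complex.I * x)) := by
  induction n generalizing P Q with
  | zero =>
    obtain ⟨a, rfl⟩ : ∃ a, P = C a := ⟨_, eq_C_of_natDegree_le_zero hP⟩
    obtain ⟨b, rfl⟩ : ∃ b, Q = C b := ⟨_, eq_C_of_natDegree_le_zero hQ⟩
    obtain ⟨θ, φ, hb⟩ := exists_angles_snd_eq_zero a b
    have hunit : ‖unrotFst θ φ a b‖ = 1 := by
      have h1 := unrot_mul_conj_add θ φ a b a b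
      have hab : a * conj a + b * conj b = 1 := by simpa using h 1 (by simp)
      rw [hb, zero_mul, add_zero, hab, Complex.mul_conj, Complex.normSq_eq_norm_sq] at h1
      have h2 : ‖unrotFst θ φ a b‖ ^ 2 = 1 := by exact_mod_cast h1
      exact (pow_eq_one_iff_of_nonneg (norm_nonneg _) two_ne_zero).1 h2
    obtain ⟨y, hy⟩ := exists_exp_mul_I_eq hunit
    refine ⟨-(2 * y), fun _ => θ, fun _ => φ, fun x => ?_⟩
    rw [Wqsp_zero]
    simp only [eval_C, pow_zero, one_mul]
    refine row_mul_Ry_mul_Rz θ φ a b _ ?_ (by simp [Rz, hb])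
    rw [← hy]
    simp only [Rz, Matrix.of_apply, Matrix.cons_val', Matrix.cons_val_zero,
      Matrix.cons_val_fin_one]
    congr 1
    push_cast
    ring
  | succ n ih =>
    obtain ⟨θ, φ, hQ0, hPn⟩ := exists_angles_of_orthogonal
      (coeff_mul_conj_coeff_zero_add_eq_zero n.succ_ne_zero hP hQ h)
    set P' : ℂ[X] := P * C (Complex.exp (Complex.I * φ / 2) * Real.cos (θ / 2)) -
      Q * C (Complex.exp (-(Complex.I * φ / 2)) * Real.sin (θ / 2)) with hP'
    set Q' : ℂ[X] := P * C (Complex.exp (Complex.I * φ / 2) * Real.sin (θ / 2)) +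
      Q * C (Complex.exp (-(Complex.I * φ / 2)) * Real.cos (θ / 2)) with hQ'
    have hPc : ∀ k, P'.coeff k = unrotFst θ φ (P.coeff k) (Q.coeff k) := fun k => by
      simp only [hP', coeff_sub, coeff_mul_C, unrotFst]
    have hQc : ∀ k, Q'.coeff k = unrotSnd θ φ (P.coeff k) (Q.coeff k) := fun k => by
      simp only [hQ', coeff_add, coeff_mul_C, unrotSnd]
    have hPe : ∀ z, P'.eval z = unrotFst θ φ (P.eval z) (Q.eval z) := fun z => by
      simp only [hP', eval_sub, eval_mul, eval_C, unrotFst]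
    have hQe : ∀ z, Q'.eval z = unrotSnd θ φ (P.eval z) (Q.eval z) := fun z => by
      simp only [hQ', eval_add, eval_mul, eval_C, unrotSnd]
    have hX : ∀ z, z * Q'.divX.eval z = unrotSnd θ φ (P.eval z) (Q.eval z) := fun z => by
      rw [← hQe]
      conv_rhs => rw [← X_mul_divX_add Q', hQc, hQ0, C_0, add_zero, eval_mul, eval_X]
    obtain ⟨ω, θs, φs, hrow⟩ := ih P' Q'.divX (by
        rw [natDegree_le_iff_coeff_eq_zero]
        intro k hk
        rcases (Nat.succ_le_of_lt hk).eq_or_lt with hk' | hk'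
        · rw [← hk', hPc]
          exact hPn
        · rw [hPc, coeff_eq_zero_of_natDegree_lt (by omega),
            coeff_eq_zero_of_natDegree_lt (by omega)]
          simp [unrotFst])
      (by
        rw [natDegree_le_iff_coeff_eq_zero]
        intro k hk
        rw [coeff_divX, hQc, coeff_eq_zero_of_natDegree_lt (by omega),
          coeff_eq_zero_of_natDegree_lt (by omega)]
        simp [unrotSnd])
      fun z hz => by
        have h1 := unrot_mul_conj_add θ φ (P.eval z) (Q.eval z) (P.eval z) (Q.eval z)
        rw [← hX, ← hPe, map_mul, h z hz] at h1
        linear_combination h1 - Q'.divX.eval z * conj (Q'.divX.eval z) *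
          conj_mul_self_of_norm_eq_one hz
    refine ⟨ω, Function.update θs (n + 1) θ, Function.update φs (n + 1) φ, fun x => ?_⟩
    rw [Wqsp_succ, Function.update_self, Function.update_self,
      Wqsp_congr (θ' := θs) (φ' := φs) (fun k hk => Function.update_of_ne (by omega) _ _)
        (fun k hk => Function.update_of_ne (by omega) _ _), ← mul_assoc]
    obtain ⟨hrow0, hrow1⟩ := hrow x
    refine row_mul_Ry_mul_Rz θ φ _ _ _ ?_ ?_
    · rw [unrotFst_smul, ← hPe]
      simp only [Rz, Matrix.mul_apply, Fin.sum_univ_two, Matrix.of_apply, Matrix.cons_val',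
        Matrix.cons_val_zero, Matrix.cons_val_one, Matrix.cons_val_fin_one, hrow0]
      ring
    · have he : Complex.exp (-(Complex.I * x / 2)) * Complex.exp (Complex.I * x) =
          Complex.exp (Complex.I * x / 2) := by
        rw [← Complex.exp_add]
        congr 1
        ring
      rw [unrotSnd_smul, ← hX]
      simp only [Rz, Matrix.mul_apply, Fin.sum_univ_two, Matrix.of_apply, Matrix.cons_val',
        Matrix.cons_val_zero, Matrix.cons_val_one, Matrix.cons_val_fin_one, hrow1]
      rw [← he]
      ring

/-- any trigonometric polynomial `F` of degree `L` with `|F(x)| ≤ 1` on ℝ is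
realized as the (0,0) entry of a trigonometric QSP unitary with `2L` layers. -/
theorem stmt_3 (L : ℕ) (c : ℤ → ℂ) (F : ℝ → ℂ)
    (hF : ∀ x : ℝ, F x =
      ∑ j ∈ Finset.Icc (-(L : ℤ)) (L : ℤ), c j * Complex.exp (Complex.I * j * x))
    (hbound : ∀ x : ℝ, ‖F x‖ ≤ 1) :
    ∃ (ω : ℝ) (θ φ : ℕ → ℝ), ∀ x : ℝ, Wqsp (2 * L) ω θ φ x 0 0 = F x := by
  set P : ℂ[X] := ∑ j ∈ Finset.Icc (-(L : ℤ)) (L : ℤ), C (c j) * X ^ (j + L).toNat with hPdef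
  have hP : P.natDegree ≤ 2 * L := by
    refine natDegree_sum_le_of_forall_le _ _ fun j hj => ?_
    refine (natDegree_C_mul_X_pow_le _ _).trans ?_
    rw [Finset.mem_Icc] at hj
    omega
  have hPF : ∀ x : ℝ, Complex.exp (-(Complex.I * x / 2)) ^ (2 * L) *
      P.eval (Complex.exp (Complex.I * x)) = F x := by
    intro x
    rw [hF, hPdef, eval_finsetSum, Finset.mul_sum]
    refine Finset.sum_congr rfl fun j hj => ?_
    rw [Finset.mem_Icc] at hj
    obtain ⟨k, hk⟩ : ∃ k : ℕ, j + L = k := ⟨(j + L).toNat, by omega⟩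
    have hj' : (j : ℂ) = k - L := by
      rw [eq_sub_iff_add_eq]
      exact_mod_cast hk
    rw [hk, Int.toNat_natCast, eval_mul, eval_C, eval_pow, eval_X, ← Complex.exp_nat_mul,
      ← Complex.exp_nat_mul, mul_left_comm, ← Complex.exp_add, hj']
    congr 2
    push_cast
    ring
  have hPbound : ∀ z : ℂ, ‖z‖ = 1 → ‖P.eval z‖ ≤ 1 := by
    intro z hz
    obtain ⟨x, rfl⟩ := exists_exp_mul_I_eq hz
    have h1 : ‖Complex.exp (-(Complex.I * x / 2))‖ = 1 := by
      rw [show -(Complex.I * (x : ℂ) / 2) = ((-(x / 2) : ℝ) : ℂ) * Complex.I by push_cast; ring]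
      exact Complex.norm_exp_ofReal_mul_I _
    have h2 := hbound x
    rwa [← hPF, norm_mul, norm_pow, h1, one_pow, one_mul, mul_comm] at h2
  obtain ⟨Q, hQ, hPQ⟩ := exists_complementary_polynomial hP hPbound
  obtain ⟨ω, θ, φ, h⟩ := exists_Wqsp_row_eq (2 * L) P Q hP hQ hPQ
  exact ⟨ω, θ, φ, fun x => by rw [(h x).1, hPF]⟩
end

section
/- There exists an absolute constant C > 0 such that for all Δ, ε ∈ (0,1) there exist L ∈ ℕ with L ≤ C·(1/Δ)·(1 + log(1/ε)) and a trigonometric polynomial F(x) = Σ_{j=−L}^{L} c_j e^{ijx} such that: (i) |F(x)| ≤ 1 for all x ∈ [−π, π], and (ii) |sgn(sin x) − F(x)| ≤ ε for all x ∈ [−π+Δ, −Δ] ∪ [Δ, π−Δ]. -/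
open Polynomial in
/-- Every real polynomial has a polynomial antiderivative, of degree at most one more. -/
lemma exists_derivative_eq (r : ℝ[X]) :
    ∃ A : ℝ[X], derivative A = r ∧ A.natDegree ≤ r.natDegree + 1 := by
  refine ⟨∑ i ∈ Finset.range (r.natDegree + 1), monomial (i + 1) (r.coeff i / (i + 1)), ?_, ?_⟩
  · conv_rhs => rw [r.as_sum_range]
    rw [derivative_sum]
    refine Finset.sum_congr rfl fun i _ => ?_
    rw [derivative_monomial]
    have : (i : ℝ) + 1 ≠ 0 := by positivity
    simp [this]
  · refine natDegree_sum_le_of_forall_le _ _ fun i hi => (natDegree_monomial_le _).trans ?_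
    have := Finset.mem_range.mp hi
    omega

open Polynomial in
/-- The normalized odd antiderivative of an even polynomial which is nonnegative on `[0, 1]`, large
near `0`, and small away from `0`, approximates the sign function. -/
lemma exists_odd_polynomial_near_sign (r : ℝ[X]) {a B K δ : ℝ} (ha : 0 < a) (ha1 : a ≤ 1)
    (hB : 0 < B) (hδ : 0 < δ) (heven : ∀ t, r.eval (-t) = r.eval t)
    (hr : ∀ t ∈ Set.Icc (0 : ℝ) 1, 0 ≤ r.eval t) (hlow : ∀ t ∈ Set.Ioo 0 a, B ≤ r.eval t)
    (hup : ∀ t ∈ Set.Icc δ 1, t ^ 2 * r.eval t ≤ K) :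
    ∃ P : ℝ[X], P.natDegree ≤ r.natDegree + 1 ∧ (∀ s, P.eval (-s) = -P.eval s) ∧
      (∀ s ∈ Set.Icc (0 : ℝ) 1, P.eval s ∈ Set.Icc (0 : ℝ) 1) ∧
      ∀ s ∈ Set.Icc δ 1, 1 - K / (δ * (a * B)) ≤ P.eval s := by
  obtain ⟨A, hA, hdeg⟩ := exists_derivative_eq r
  set S : ℝ[X] := A - A.comp (-X) with hS
  have hSev (s : ℝ) : S.eval s = A.eval s - A.eval (-s) := by simp [hS]
  have hS0 : S.eval 0 = 0 := by simp [hSev]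
  have hSdeg : S.natDegree ≤ r.natDegree + 1 := by
    rw [hS, ← max_self (r.natDegree + 1)]
    refine natDegree_sub_le_of_le hdeg ?_
    simpa [natDegree_comp] using hdeg
  have hSd (s : ℝ) : deriv (fun t => S.eval t) s = 2 * r.eval s := by
    rw [Polynomial.deriv, hS, derivative_sub, derivative_comp, hA]
    simp [heven]
    ring
  have hmono : MonotoneOn (fun t => S.eval t) (Set.Icc 0 1) := by
    refine monotoneOn_of_deriv_nonneg (convex_Icc 0 1) S.continuous.continuousOn
      S.differentiable.differentiableOn fun t ht => ?_
    rw [hSd]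
    have := hr t (interior_subset ht)
    linarith
  have hSa : 2 * (a * B) ≤ S.eval 1 := by
    have h1 := (convex_Icc 0 a).mul_sub_le_image_sub_of_le_deriv (f := fun t => S.eval t)
      S.continuous.continuousOn S.differentiable.differentiableOn (C := 2 * B)
      (fun t ht => by
        rw [interior_Icc] at ht
        rw [hSd]
        linarith [hlow t ht])
      0 ⟨le_rfl, ha.le⟩ a ⟨ha.le, le_rfl⟩ ha.le
    have h2 := hmono ⟨ha.le, ha1⟩ ⟨zero_le_one, le_rfl⟩ ha1
    simp only [hS0] at h1 h2
    linarith
  have haB : 0 < a * B := mul_pos ha hB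
  have hS1 : 0 < S.eval 1 := by linarith
  refine ⟨C (S.eval 1)⁻¹ * S, (natDegree_C_mul_le _ _).trans hSdeg, ?_, ?_, ?_⟩
  · intro s
    simp only [eval_mul, eval_C, hSev, neg_neg]
    ring
  · intro s hs
    have h1 := hmono ⟨le_rfl, zero_le_one⟩ hs hs.1
    have h2 := hmono hs ⟨zero_le_one, le_rfl⟩ hs.2
    simp only [hS0] at h1 h2
    rw [eval_mul, eval_C, inv_mul_eq_div]
    exact ⟨by positivity, (div_le_one hS1).2 h2⟩
  · intro s hs
    have hanti : AntitoneOn (fun t => S.eval t + 2 * K * t⁻¹) (Set.Icc δ 1) := by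
      have hd (t : ℝ) (ht : 0 < t) :
          HasDerivAt (fun t => S.eval t + 2 * K * t⁻¹) (2 * r.eval t + 2 * K * (-(t ^ 2)⁻¹)) t := by
        have h := S.differentiable.differentiableAt (x := t) |>.hasDerivAt
        rw [hSd] at h
        exact h.add ((hasDerivAt_inv ht.ne').const_mul _)
      refine antitoneOn_of_deriv_nonpos (convex_Icc δ 1)
        (fun t ht => (hd t (hδ.trans_le ht.1)).continuousAt.continuousWithinAt)
        (fun t ht => (hd t
          (hδ.trans_le (interior_subset ht).1)).differentiableAt.differentiableWithinAt)
        fun t ht => ?_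
      have ht' := interior_subset ht
      have ht0 : 0 < t := hδ.trans_le ht'.1
      rw [(hd t ht0).deriv]
      have : r.eval t ≤ K * (t ^ 2)⁻¹ := by
        rw [← div_eq_mul_inv, le_div_iff₀ (by positivity)]
        linarith [hup t ht']
      linarith
    have hs0 : 0 < s := hδ.trans_le hs.1
    have hK : 0 ≤ K := (mul_nonneg (sq_nonneg _) (hr s ⟨hs0.le, hs.2⟩)).trans (hup s hs)
    have h := hanti hs ⟨hs.1.trans hs.2, le_rfl⟩ hs.2
    have h3 : s⁻¹ ≤ δ⁻¹ := inv_anti₀ hδ hs.1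
    have h4 : S.eval 1 - 2 * K * δ⁻¹ ≤ S.eval s := by
      have := mul_le_mul_of_nonneg_left h3 (by positivity : 0 ≤ 2 * K)
      simp only [inv_one, mul_one] at h
      linarith
    have h5 : 2 * K * δ⁻¹ ≤ K / (δ * (a * B)) * S.eval 1 := by
      have h6 : 0 ≤ K / (δ * (a * B)) := by positivity
      have := mul_le_mul_of_nonneg_left hSa h6
      refine le_trans (le_of_eq ?_) this
      field_simp
    rw [eval_mul, eval_C, inv_mul_eq_div, le_div_iff₀ hS1]
    linarith

open Polynomial in
/-- An odd polynomial of degree `O(1/δ)`, bounded by `1` on `[-1, 1]` and at least `1/2` on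
`[δ, 1]`. -/
lemma exists_odd_polynomial_half (m : ℕ) {δ : ℝ} (hδ : 0 < δ) (hm : 10 ≤ δ * (4 * m + 1)) :
    ∃ P : ℝ[X], P.natDegree ≤ 2 * (4 * m + 1) + 1 ∧ (∀ s, P.eval (-s) = -P.eval s) ∧
      (∀ s ∈ Set.Icc (0 : ℝ) 1, P.eval s ∈ Set.Icc (0 : ℝ) 1) ∧
      ∀ s ∈ Set.Icc δ 1, 1 / 2 ≤ P.eval s := by
  set N : ℝ := 4 * m + 1 with hN
  have hN1 : 1 ≤ N := by rw [hN]; linarith [(Nat.cast_nonneg m : (0 : ℝ) ≤ m)]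
  have hN0 : 0 < N := by linarith
  set T := Chebyshev.T ℝ ((4 * m + 1 : ℕ) : ℤ) with hT
  have hTsin (φ : ℝ) : T.eval (Real.sin φ) = Real.sin (N * φ) := by
    rw [← Real.cos_pi_div_two_sub, hT, Chebyshev.T_real_cos, ← Real.cos_pi_div_two_sub,
      ← Real.cos_sub_nat_mul_two_pi _ m]
    congr 1
    push_cast
    rw [hN]
    ring
  set q := T.divX with hq
  have hTq (t : ℝ) : t * q.eval t = T.eval t := by
    have h0 : T.coeff 0 = 0 := by
      have := hTsin 0
      rw [coeff_zero_eq_eval_zero]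
      simpa using this
    conv_rhs => rw [← X_mul_divX_add T, h0]
    simp [hq]
  have hqdeg : q.natDegree ≤ 4 * m + 1 := by
    refine natDegree_divX_le.trans ?_
    rw [hT, Chebyshev.natDegree_T, Int.natAbs_natCast]
  have hbd {t : ℝ} (ht : |t| ≤ 1) : t ^ 2 * q.eval t ^ 2 ≤ 1 := by
    rw [← mul_pow, hTq, sq_le_one_iff_abs_le_one]
    exact Chebyshev.abs_eval_T_real_le_one _ ht
  obtain ⟨P, hdeg, hodd, hP, hP'⟩ := exists_odd_polynomial_near_sign
    (q ^ 2 + q.comp (-X) ^ 2) (a := 1 / N) (B := (2 / Real.pi * N) ^ 2) (K := 2) (δ := δ)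
    (by positivity) ((div_le_one hN0).2 hN1) (by positivity) hδ
    (fun t => by simp [add_comm])
    (fun t _ => by
      simp only [eval_add, eval_pow]
      positivity)
    (fun t ht => by
      have ht1 : t < 1 := ht.2.trans_le ((div_le_one hN0).2 hN1)
      have hNt : N * t ≤ 1 := by
        have := (lt_div_iff₀ hN0).1 ht.2
        linarith
      have hsin : Real.sin (Real.arcsin t) = t := Real.sin_arcsin (by linarith [ht.1]) ht1.le
      have h0 : 0 ≤ Real.arcsin t := Real.arcsin_nonneg.2 ht.1.le
      have h1 : t ≤ Real.arcsin t := by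
        have := Real.sin_le h0
        rwa [hsin] at this
      have h2 : Real.arcsin t ≤ Real.pi / 2 * t := by
        have := Real.mul_le_sin h0 (Real.arcsin_le_pi_div_two t)
        rw [hsin] at this
        have hpi := Real.pi_pos
        calc Real.arcsin t = Real.pi / 2 * (2 / Real.pi * Real.arcsin t) := by field_simp
          _ ≤ _ := by gcongr
      have h3 : 2 / Real.pi * (N * Real.arcsin t) ≤ Real.sin (N * Real.arcsin t) := by
        refine Real.mul_le_sin (by positivity) ?_
        have hpi := Real.pi_pos
        calc N * Real.arcsin t ≤ N * (Real.pi / 2 * t) := by gcongr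
          _ = Real.pi / 2 * (N * t) := by ring
          _ ≤ Real.pi / 2 * 1 := by gcongr
          _ = _ := mul_one _
      rw [← hTsin, hsin, ← hTq] at h3
      have h4 : 2 / Real.pi * N ≤ q.eval t := by
        have h5 : t * (2 / Real.pi * N) ≤ t * q.eval t := by
          refine le_trans ?_ h3
          calc t * (2 / Real.pi * N) = 2 / Real.pi * (N * t) := by ring
            _ ≤ _ := by gcongr
        exact le_of_mul_le_mul_left h5 ht.1
      have h6 : (2 / Real.pi * N) ^ 2 ≤ q.eval t ^ 2 := by gcongr
      simp only [eval_add, eval_pow]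
      linarith [sq_nonneg ((q.comp (-X)).eval t)])
    (fun t ht => by
      have habs : |t| ≤ 1 := abs_le.2 ⟨by linarith [ht.1], ht.2⟩
      have h1 := hbd habs
      have h2 := hbd (t := -t) (by rwa [abs_neg])
      simp only [eval_add, eval_pow, eval_comp, eval_neg, eval_X]
      linarith)
  refine ⟨P, hdeg.trans ?_, hodd, hP, fun s hs => le_trans ?_ (hP' s hs)⟩
  · refine Nat.succ_le_succ (natDegree_add_le_of_degree_le ?_ ?_)
    · exact natDegree_pow_le_of_le 2 hqdeg
    · refine natDegree_pow_le_of_le 2 ?_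
      simpa [natDegree_comp] using hqdeg
  · have hpi : Real.pi ^ 2 ≤ 10 := by
      have := Real.pi_lt_d2
      nlinarith [Real.pi_pos]
    have h : 2 / (δ * (1 / N * (2 / Real.pi * N) ^ 2)) = Real.pi ^ 2 / (2 * (δ * N)) := by
      have := Real.pi_ne_zero
      field_simp
    have h' : Real.pi ^ 2 / (2 * (δ * N)) ≤ 1 / 2 := by
      rw [div_le_iff₀ (by positivity)]
      linarith
    linarith

open Polynomial in
/-- An odd polynomial of degree `O(log (1/ε))`, bounded by `1` on `[-1, 1]` and within `ε` of `1` on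
`[1/2, 1]`. -/
lemma exists_odd_polynomial_amplify (n : ℕ) {ε : ℝ} (hε : 0 < ε) (hε1 : ε ≤ 1)
    (hn : 15 * (1 + Real.log (1 / ε)) ≤ n) :
    ∃ P : ℝ[X], P.natDegree ≤ 2 * n + 1 ∧ (∀ s, P.eval (-s) = -P.eval s) ∧
      (∀ s ∈ Set.Icc (0 : ℝ) 1, P.eval s ∈ Set.Icc (0 : ℝ) 1) ∧
      ∀ s ∈ Set.Icc (1 / 2 : ℝ) 1, 1 - ε ≤ P.eval s := by
  obtain ⟨P, hdeg, hodd, hP, hP'⟩ := exists_odd_polynomial_near_sign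
    ((1 - X ^ 2) ^ n) (a := 1 / 4) (B := (15 / 16) ^ n) (K := (3 / 4) ^ n) (δ := 1 / 2)
    (by norm_num) (by norm_num) (by positivity) (by norm_num)
    (fun t => by simp)
    (fun t ht => by
      simp only [eval_pow, eval_sub, eval_one, eval_X]
      have : 0 ≤ 1 - t ^ 2 := by nlinarith [ht.1, ht.2]
      positivity)
    (fun t ht => by
      simp only [eval_pow, eval_sub, eval_one, eval_X]
      refine pow_le_pow_left₀ (by norm_num) ?_ n
      nlinarith [ht.1, ht.2])
    (fun t ht => by
      simp only [eval_pow, eval_sub, eval_one, eval_X]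
      have h0 : 0 ≤ 1 - t ^ 2 := by nlinarith [ht.1, ht.2]
      have h1 : (1 - t ^ 2) ^ n ≤ (3 / 4 : ℝ) ^ n :=
        pow_le_pow_left₀ h0 (by nlinarith [ht.1, ht.2]) n
      have h2 : 0 ≤ (1 - t ^ 2) ^ n := by positivity
      nlinarith)
  refine ⟨P, hdeg.trans ?_, hodd, hP, fun s hs => le_trans ?_ (hP' s hs)⟩
  · refine Nat.succ_le_succ ?_
    rw [mul_comm 2 n]
    refine natDegree_pow_le_of_le n ?_
    compute_degree
  · have h1 : (3 / 4 : ℝ) ^ n / (1 / 2 * (1 / 4 * (15 / 16) ^ n)) = 8 * (4 / 5) ^ n := by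
      rw [show (3 / 4 : ℝ) = 15 / 16 * (4 / 5) by norm_num, mul_pow]
      field_simp
      norm_num
    have h2 : (4 / 5 : ℝ) ^ n ≤ Real.exp (-(n / 5)) := by
      have h : (4 / 5 : ℝ) ≤ Real.exp (-(1 / 5)) := by
        have := Real.add_one_le_exp (-(1 / 5) : ℝ)
        linarith
      refine (pow_le_pow_left₀ (by norm_num) h n).trans_eq ?_
      rw [← Real.exp_nat_mul]
      congr 1
      ring
    have hx : (8 : ℝ) ≤ Real.exp 3 := by
      have h : (2 : ℝ) ≤ Real.exp 1 := by linarith [Real.add_one_le_exp (1 : ℝ)]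
      calc (8 : ℝ) = 2 ^ 3 := by norm_num
        _ ≤ Real.exp 1 ^ 3 := pow_le_pow_left₀ (by norm_num) h 3
        _ = Real.exp 3 := by rw [← Real.exp_nat_mul]; norm_num
    have hlog : 0 ≤ Real.log (1 / ε) := Real.log_nonneg ((one_le_div hε).2 hε1)
    have h3 : Real.exp (-(n / 5)) ≤ Real.exp (-3) * ε := by
      calc Real.exp (-(n / 5)) ≤ Real.exp (-3 + -Real.log (1 / ε)) :=
            Real.exp_le_exp.2 (by linarith)
        _ = Real.exp (-3) * ε := by
            rw [Real.exp_add, one_div, Real.log_inv, neg_neg, Real.exp_log hε]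
    have h4 : 8 * Real.exp (-3) ≤ 1 := by
      rw [Real.exp_neg, ← div_eq_mul_inv]
      exact (div_le_one (Real.exp_pos 3)).2 hx
    have h5 := mul_le_mul_of_nonneg_right h4 hε.le
    rw [h1]
    linarith

/-- A polynomial in `sin x` is a trigonometric polynomial of the same degree. -/
lemma exists_trigonometric_sum_eq (G : Polynomial ℝ) (L : ℕ) (hL : G.natDegree ≤ L) :
    ∃ c : ℤ → ℂ, ∀ x : ℝ, ∑ j ∈ Finset.Icc (-(L : ℤ)) (L : ℤ),
      c j * Complex.exp (Complex.I * j * x) = ((G.eval (Real.sin x) : ℝ) : ℂ) := by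
  let e : ℤ → ℝ → ℂ := fun j x => Complex.exp (Complex.I * j * x)
  let V : Submodule ℂ (ℝ → ℂ) := Submodule.span ℂ (e '' Finset.Icc (-(L : ℤ)) (L : ℤ))
  have he {j : ℤ} (h1 : -(L : ℤ) ≤ j) (h2 : j ≤ L) : e j ∈ V :=
    Submodule.subset_span ⟨j, by simp [h1, h2], rfl⟩
  have hpow (k : ℕ) (hk : k ≤ L) : (fun x : ℝ => (Complex.sin x) ^ k) ∈ V := by
    have : (fun x : ℝ => (Complex.sin x) ^ k) = ∑ i ∈ Finset.range (k + 1),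
        ((Complex.I / 2) ^ k * (-1) ^ (k - i) * (k.choose i : ℂ)) • e (k - 2 * i : ℤ) := by
      funext x
      rw [Finset.sum_apply]
      have hsin : Complex.sin x = Complex.I / 2 *
          (Complex.exp (-x * Complex.I) + -1 * Complex.exp (x * Complex.I)) := by
        rw [Complex.sin]
        ring
      rw [hsin, mul_pow, add_pow, Finset.mul_sum]
      refine Finset.sum_congr rfl fun i hi => ?_
      have hik : i ≤ k := Nat.lt_succ_iff.1 (Finset.mem_range.1 hi)
      have hexp : e (k - 2 * i : ℤ) x =
          Complex.exp (-x * Complex.I) ^ i * Complex.exp (x * Complex.I) ^ (k - i) := by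
        simp only [e]
        rw [← Complex.exp_nat_mul, ← Complex.exp_nat_mul, ← Complex.exp_add]
        congr 1
        push_cast [Nat.cast_sub hik]
        ring
      rw [Pi.smul_apply, hexp, smul_eq_mul, mul_pow (-1 : ℂ)]
      ring
    rw [this]
    refine Submodule.sum_mem _ fun i hi => Submodule.smul_mem _ _ (he ?_ ?_) <;>
    · have := Finset.mem_range.1 hi
      omega
  have hG : (fun x : ℝ => ((G.eval (Real.sin x) : ℝ) : ℂ)) ∈ V := by
    have : (fun x : ℝ => ((G.eval (Real.sin x) : ℝ) : ℂ)) =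
        ∑ k ∈ Finset.range (G.natDegree + 1), (G.coeff k : ℂ) • fun x : ℝ => (Complex.sin x) ^ k := by
      funext x
      rw [Polynomial.eval_eq_sum_range, Finset.sum_apply]
      simp
    rw [this]
    refine Submodule.sum_mem _ fun k hk => Submodule.smul_mem _ _ (hpow k ?_)
    have := Finset.mem_range.1 hk
    omega
  obtain ⟨c, hc⟩ := Submodule.mem_span_image_finset_iff_exists_fun' ℂ |>.1 hG
  refine ⟨c, fun x => ?_⟩
  simpa [e, Finset.sum_apply] using congrFun hc x

/-- trigonometric approximation of the square wave function
`sqw(x) = sgn(sin x)`: there is an absolute constant `C > 0` such that for all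
`Δ, ε ∈ (0,1)` there is a trigonometric polynomial of degree
`L ≤ C·(1/Δ)·(1 + log(1/ε))` which is bounded by `1` on `[-π, π]` and `ε`-close to
`sgn(sin x)` on `[-π+Δ, -Δ] ∪ [Δ, π-Δ]`. -/
theorem stmt_9 :
    ∃ C : ℝ, 0 < C ∧
      ∀ Δ ε : ℝ, Δ ∈ Set.Ioo (0 : ℝ) 1 → ε ∈ Set.Ioo (0 : ℝ) 1 →
        ∃ (L : ℕ) (c : ℤ → ℂ),
          (L : ℝ) ≤ C * (1 / Δ) * (1 + Real.log (1 / ε)) ∧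
          (∀ x ∈ Set.Icc (-Real.pi) Real.pi,
            ‖∑ j ∈ Finset.Icc (-(L : ℤ)) (L : ℤ), c j * Complex.exp (Complex.I * j * x)‖ ≤ 1) ∧
          (∀ x ∈ Set.Icc (-Real.pi + Δ) (-Δ) ∪ Set.Icc Δ (Real.pi - Δ),
            ‖(Real.sign (Real.sin x) : ℂ) -
                ∑ j ∈ Finset.Icc (-(L : ℤ)) (L : ℤ), c j * Complex.exp (Complex.I * j * x)‖
              ≤ ε) := by
  refine ⟨1683, by norm_num, fun Δ ε ⟨hΔ0, hΔ1⟩ ⟨hε0, hε1⟩ => ?_⟩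
  have hlog : 0 ≤ Real.log (1 / ε) := Real.log_nonneg ((one_le_div hε0).2 hε1.le)
  set ℓ := Real.log (1 / ε) with hℓ
  set m := ⌈5 / Δ⌉₊ with hm
  set n := ⌈15 * (1 + ℓ)⌉₊ with hn
  have hm1 : 5 / Δ ≤ m := Nat.le_ceil _
  have hm2 : (m : ℝ) < 5 / Δ + 1 := Nat.ceil_lt_add_one (by positivity)
  have hn1 : 15 * (1 + ℓ) ≤ n := Nat.le_ceil _
  have hn2 : (n : ℝ) < 15 * (1 + ℓ) + 1 := Nat.ceil_lt_add_one (by positivity)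
  have hΔinv : 1 ≤ 1 / Δ := (one_le_div hΔ0).2 hΔ1.le
  obtain ⟨P, hPdeg, hPodd, hP, hP'⟩ := exists_odd_polynomial_half m (δ := Δ / 2) (by positivity)
    (by
      rw [div_le_iff₀ hΔ0] at hm1
      linarith)
  obtain ⟨Q, hQdeg, hQodd, hQ, hQ'⟩ := exists_odd_polynomial_amplify n hε0 hε1.le hn1
  set G := Q.comp P with hG
  have hGodd (s : ℝ) : G.eval (-s) = -G.eval s := by simp [hG, hPodd, hQodd]
  have hG1 (s : ℝ) (hs : s ∈ Set.Icc (0 : ℝ) 1) : G.eval s ∈ Set.Icc (0 : ℝ) 1 := by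
    rw [hG, Polynomial.eval_comp]
    exact hQ _ (hP s hs)
  have hGabs (x : ℝ) : |G.eval (Real.sin x)| ≤ 1 := by
    rcases le_total 0 (Real.sin x) with h | h
    · have := hG1 _ ⟨h, Real.sin_le_one x⟩
      exact abs_le.2 ⟨by linarith [this.1], this.2⟩
    · have := hG1 (-Real.sin x) ⟨by linarith, by linarith [Real.neg_one_le_sin x]⟩
      rw [hGodd] at this
      exact abs_le.2 ⟨by linarith [this.2], by linarith [this.1]⟩
  have hpos (x : ℝ) (hx : x ∈ Set.Icc Δ (Real.pi - Δ)) :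
      0 < Real.sin x ∧ |1 - G.eval (Real.sin x)| ≤ ε := by
    have hjordan (y : ℝ) (h1 : Δ ≤ y) (h2 : y ≤ Real.pi / 2) : Δ / 2 ≤ Real.sin y := by
      refine le_trans ?_ (Real.mul_le_sin (hΔ0.le.trans h1) h2)
      have : 1 / 2 ≤ 2 / Real.pi := by
        rw [div_le_div_iff₀ two_pos Real.pi_pos]
        linarith [Real.pi_le_four]
      calc Δ / 2 = 1 / 2 * Δ := by ring
        _ ≤ 2 / Real.pi * y := by gcongr
    have hsin : Δ / 2 ≤ Real.sin x := by
      rcases le_total x (Real.pi / 2) with h | h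
      · exact hjordan x hx.1 h
      · rw [← Real.sin_pi_sub]
        exact hjordan _ (by linarith [hx.2]) (by linarith)
    have hsin0 : 0 < Real.sin x := by linarith
    refine ⟨hsin0, ?_⟩
    have h1 := hP' _ ⟨hsin, Real.sin_le_one x⟩
    have h2 := (hP _ ⟨hsin0.le, Real.sin_le_one x⟩).2
    have h3 := hQ' _ ⟨h1, h2⟩
    have h4 := (hG1 _ ⟨hsin0.le, Real.sin_le_one x⟩).2
    rw [hG, Polynomial.eval_comp] at h4 ⊢
    exact abs_le.2 ⟨by linarith, by linarith⟩
  obtain ⟨c, hc⟩ := exists_trigonometric_sum_eq G G.natDegree le_rfl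
  refine ⟨G.natDegree, c, ?_, fun x _ => ?_, fun x hx => ?_⟩
  · have h1 : G.natDegree ≤ (2 * n + 1) * (2 * (4 * m + 1) + 1) :=
      Polynomial.natDegree_comp_le.trans (Nat.mul_le_mul hQdeg hPdeg)
    have h2 : (G.natDegree : ℝ) ≤ (2 * n + 1) * (2 * (4 * m + 1) + 1) := by exact_mod_cast h1
    have h3 : 2 * (4 * (m : ℝ) + 1) + 1 ≤ 51 * (1 / Δ) := by
      have : 5 / Δ = 5 * (1 / Δ) := by ring
      linarith
    have h4 : 2 * (n : ℝ) + 1 ≤ 33 * (1 + ℓ) := by linarith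
    calc (G.natDegree : ℝ) ≤ (2 * n + 1) * (2 * (4 * m + 1) + 1) := h2
      _ ≤ (33 * (1 + ℓ)) * (51 * (1 / Δ)) := by gcongr
      _ = _ := by ring
  · rw [hc, Complex.norm_real]
    exact hGabs x
  · rw [hc, ← Complex.ofReal_sub, Complex.norm_real, Real.norm_eq_abs]
    rcases hx with hx | hx
    · obtain ⟨h1, h2⟩ := hpos (-x) ⟨by linarith [hx.2], by linarith [hx.1]⟩
      rw [Real.sin_neg] at h1 h2
      rw [Real.sign_of_neg (by linarith), ← abs_neg]
      rw [hGodd] at h2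
      convert h2 using 2
      ring
    · obtain ⟨h1, h2⟩ := hpos x hx
      rwa [Real.sign_of_pos h1]
end
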